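/- Let n ∈ {4,5,6,7} and let G be a simple graph on n vertices with minimum degree at least ⌊n/2⌋ + 1. Then G has property (*). -/

import Mathlib

open SimpleGraph

universe u

variable {V : Type u}

/-- `T` is a spanning tree of `G`: a subgraph on the same vertex set which is
connected and acyclic. -/
def IsSpanningTree (G T : SimpleGraph V) : Prop :=
  T ≤ G ∧ T.Connected ∧ T.IsAcyclic

/-- A 2T-graph: a graph on at least two vertices whose edge set is the disjoint
union of the edge sets of two edge-disjoint spanning trees. -/
def IsTwoT (G : SimpleGraph V) : Prop :=
  2 ≤ Nat.card V ∧
    ∃ I O : SimpleGraph V,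
      IsSpanningTree G I ∧ IsSpanningTree G O ∧ I ⊓ O = ⊥ ∧ I ⊔ O = G

/-- An `(s,t)`-triple of `G`: a total (linear) order on the vertices together with two
edge-disjoint spanning trees `I` and `O` of `G` such that every vertex except `t` has a
larger neighbor in `I`, and every vertex except `s` has a smaller neighbor in `O`. -/
def HasSTTriple (G : SimpleGraph V) (s t : V) : Prop :=
  ∃ (r : LinearOrder V) (I O : SimpleGraph V),
    IsSpanningTree G I ∧ IsSpanningTree G O ∧ I ⊓ O = ⊥ ∧
    (∀ v, v ≠ t → ∃ w, I.Adj v w ∧ r.lt v w) ∧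
    (∀ v, v ≠ s → ∃ w, O.Adj v w ∧ r.lt w v)

/-- The degree of a vertex. -/
noncomputable def gdeg (G : SimpleGraph V) (v : V) : ℕ := (G.neighborSet v).ncard

/-- A quartic: a (simple) 2T-graph in which every vertex has degree 3 or 4. -/
def IsQuartic (G : SimpleGraph V) : Prop :=
  IsTwoT G ∧ ∀ v : V, gdeg G v = 3 ∨ gdeg G v = 4

/-- A transit of a quartic: a vertex of degree 3. -/
def IsTransit (G : SimpleGraph V) (v : V) : Prop := gdeg G v = 3

/-- A quartic is excellent if it admits an `(s,t)`-triple for every pair of distinct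
transits `s`, `t`. -/
def Excellent (G : SimpleGraph V) : Prop :=
  ∀ s t : V, IsTransit G s → IsTransit G t → s ≠ t → HasSTTriple G s t

/-- The edge neighborhood of a vertex set `S`: all edges of `G` with exactly one
endpoint in `S`. -/
def edgeNbhd (G : SimpleGraph V) (S : Set V) : Set (Sym2 V) :=
  {e | ∃ u v : V, e = s(u, v) ∧ G.Adj u v ∧ u ∈ S ∧ v ∉ S}

/-- A set of edges is a matching if no two distinct edges share an endpoint. -/
def IsMatchingSet (M : Set (Sym2 V)) : Prop :=
  ∀ e ∈ M, ∀ f ∈ M, e ≠ f → ∀ v : V, v ∈ e → v ∉ f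

/-- A quartic is normal if the edge neighborhood of every proper subquartic is a
matching of size 3 or 4. -/
def NormalQuartic (G : SimpleGraph V) : Prop :=
  ∀ H : G.Subgraph, IsQuartic H.coe → H ≠ ⊤ →
    IsMatchingSet (edgeNbhd G H.verts) ∧
      ((edgeNbhd G H.verts).ncard = 3 ∨ (edgeNbhd G H.verts).ncard = 4)

/-- A generic circuit: a 2T-graph with no proper subgraph which is a 2T-graph. -/
def IsGenericCircuit (G : SimpleGraph V) : Prop :=
  IsTwoT G ∧ ∀ H : G.Subgraph, IsTwoT H.coe → H = ⊤

/-- Property (*): for every pair of distinct vertices `s, t` there is a spanning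
subgraph which is a 2T-graph and admits an `(s,t)`-triple. -/
def PropertyStar (G : SimpleGraph V) : Prop :=
  ∀ s t : V, s ≠ t → ∃ H : SimpleGraph V, H ≤ G ∧ IsTwoT H ∧ HasSTTriple H s t

/-- `G` is obtained by identifying two disjoint copies of the complete graph `K_k`
at a single vertex. -/
def IsTwoCliquesAtVertex (G : SimpleGraph V) (k : ℕ) : Prop :=
  ∃ (A B : Set V) (x : V), A ∩ B = {x} ∧ A ∪ B = Set.univ ∧ A.ncard = k ∧ B.ncard = k ∧
    ∀ u v : V, G.Adj u v ↔ u ≠ v ∧ ((u ∈ A ∧ v ∈ A) ∨ (u ∈ B ∧ v ∈ B))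

/-- The number encoding the edge between `i` and `j` in a graph on `{0, …, n - 1}`. -/
def edgeCode (n i j : ℕ) : ℕ := n * min i j + max i j

/-- The bit mask of a list of numbers. -/
def maskOf (l : List ℕ) : ℕ := l.foldr (fun i m => 2 ^ i ||| m) 0

/-- The number of edges of the mask `A` at the vertex `v`. -/
def maskDegree (n A v : ℕ) : ℕ :=
  ((List.range n).filter fun w => w != v && A.testBit (edgeCode n v w)).length

/-- Some endpoint of the edge coded by `i` has degree more than `d` in the mask `A`. -/
def overfull (n d A i : ℕ) : Bool :=
  (Nat.blt (i / n) n && Nat.blt d (maskDegree n A (i / n))) ||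
    (Nat.blt (i % n) n && Nat.blt d (maskDegree n A (i % n)))

/-- Search, with fuel, verifying that a graph containing all edges of `P`, avoiding all edges
of `A`, and missing at most `d` edges at each vertex contains one of the edge sets in `L`. -/
def covers (n d : ℕ) : ℕ → List ℕ → ℕ → ℕ → Bool
  | 0, _, _, _ => false
  | k + 1, L, A, P =>
    match L.dropWhile fun m => Nat.blt 0 (m &&& A) with
    | [] => false
    | m :: L' =>
      let u := m ^^^ (m &&& P)
      Nat.beq u 0 ||
        (covers n d k (m :: L') A (P ||| 2 ^ u.log2) &&
          (overfull n d (A ||| 2 ^ u.log2) u.log2 ||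
            covers n d k (m :: L') (A ||| 2 ^ u.log2) P))

/-- Pairs `(up, down)` of lists, assigning to each position of a linear order a later position
and an earlier position. -/
def schemes : ℕ → List (List ℕ × List ℕ)
  | 4 => [([2, 3, 3], [0, 0, 1, 0])]
  | 5 => [([3, 4, 4, 4], [0, 0, 1, 2, 0]), ([2, 3, 4, 4], [0, 0, 1, 0, 1]),
      ([2, 3, 4, 4], [0, 0, 1, 2, 0]), ([2, 3, 4, 4], [0, 0, 1, 0, 0])]
  | 6 => [([2, 3, 4, 5, 5], [0, 0, 1, 0, 3, 2])]
  | 7 => [([2, 4, 6, 6, 5, 6], [0, 0, 1, 0, 3, 2, 0]), ([3, 4, 5, 6, 5, 6], [0, 0, 1, 2, 3, 0, 1]),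
      ([2, 4, 5, 6, 6, 6], [0, 0, 1, 0, 3, 3, 1]), ([3, 4, 6, 5, 6, 6], [0, 0, 1, 2, 2, 4, 0]),
      ([2, 4, 6, 5, 6, 6], [0, 0, 1, 2, 3, 4, 0]), ([2, 4, 5, 6, 6, 6], [0, 0, 1, 0, 3, 3, 0]),
      ([2, 4, 6, 6, 5, 6], [0, 0, 1, 0, 3, 3, 1])]
  | _ => []

/-- The orderings of `{0, …, n - 1}` from `0` to `n - 1`. -/
def orders (n : ℕ) : List (List ℕ) :=
  (List.range' 1 (n - 2)).permutations'.map fun l => 0 :: (l ++ [n - 1])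

/-- The codes of the edges used by a scheme `p.2` along the ordering `p.1`. -/
def schemeEdges (n : ℕ) (p : List ℕ × List ℕ × List ℕ) : List ℕ :=
  ((List.range (n - 1)).map fun i =>
      edgeCode n (p.1.getD i 0) (p.1.getD (p.2.1.getD i 0) 0)) ++
    (List.range' 1 (n - 1)).map fun i =>
      edgeCode n (p.1.getD i 0) (p.1.getD (p.2.2.getD i 0) 0)

/-- The masks of all schemes along all orderings. -/
def schemeMasks (n : ℕ) : List ℕ :=
  ((orders n).product (schemes n)).map fun p => maskOf (schemeEdges n p)

/-- The edges joining the end `0` or `n - 1` to the interior that are missing when the interior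
is sorted by adjacency to `0` and then by adjacency to `n - 1`, with thresholds `a ≤ b ≤ c`. -/
def missingEnds (n a b c : ℕ) : List ℕ :=
  ((List.range' 1 (n - 2)).filter (· ≤ b)).map (edgeCode n 0) ++
    ((List.range' 1 (n - 2)).filter fun i => i ≤ a ∨ b < i ∧ i ≤ c).map (edgeCode n (n - 1))

/-- The edges joining the ends to the interior that are not in `missingEnds n a b c`. -/
def presentEnds (n a b c : ℕ) : List ℕ :=
  ((List.range' 1 (n - 2)).filter fun i => ¬ i ≤ b).map (edgeCode n 0) ++
    ((List.range' 1 (n - 2)).filter fun i => ¬ (i ≤ a ∨ b < i ∧ i ≤ c)).map (edgeCode n (n - 1))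

/-- The search succeeds for all choices of thresholds. -/
def coverCheck (n : ℕ) : Bool :=
  (List.range (n - 1)).all fun c => (List.range (c + 1)).all fun b => (List.range (b + 1)).all
    fun a => (missingEnds n a b c).any (overfull n (n - 2 - n / 2) (maskOf (missingEnds n a b c))) ||
      covers n (n - 2 - n / 2) 30 (schemeMasks n) (maskOf (missingEnds n a b c))
        (maskOf (presentEnds n a b c))

theorem coverCheck_eq_true : ∀ n ∈ [4, 5, 6, 7], coverCheck n = true := by decide +kernel

theorem testBit_maskOf (l : List ℕ) (i : ℕ) : (maskOf l).testBit i = true ↔ i ∈ l := by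
  induction l with
  | nil => simp [maskOf]
  | cons j l ih =>
    have : maskOf (j :: l) = 2 ^ j ||| maskOf l := rfl
    simp [this, Nat.testBit_or, Nat.testBit_two_pow, ih, eq_comm (a := j)]

theorem testBit_or_two_pow {A i j : ℕ} (h : (A ||| 2 ^ i).testBit j = true) :
    A.testBit j = true ∨ j = i := by
  simpa [Nat.testBit_or, Nat.testBit_two_pow, eq_comm (a := i)] using h

theorem exists_of_covers {n d : ℕ} {x : ℕ → Prop}
    (hx : ∀ A i, (∀ j, A.testBit j = true → ¬ x j) → overfull n d A i = false)
    (k : ℕ) (L : List ℕ) (A P : ℕ) (h : covers n d k L A P = true)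
    (hP : ∀ j, P.testBit j = true → x j) (hA : ∀ j, A.testBit j = true → ¬ x j) :
    ∃ m ∈ L, ∀ j, m.testBit j = true → x j := by
  induction k generalizing L A P with
  | zero => simp [covers] at h
  | succ k ih =>
    rw [covers] at h
    have hsub := (List.dropWhile_suffix (l := L) fun m => Nat.blt 0 (m &&& A)).subset
    split at h
    · simp at h
    · next m L' hL =>
      rw [hL] at hsub
      simp only [Bool.or_eq_true, Bool.and_eq_true, Nat.beq_eq] at h
      rcases h with h | ⟨h₁, h₂⟩
      · refine ⟨m, hsub (by simp), fun j hj => hP j ?_⟩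
        have hbit := congrArg (fun a => a.testBit j) h
        simpa [Nat.testBit_xor, Nat.testBit_and, hj] using hbit
      · have hmem : ∀ {B : ℕ → Prop}, (∃ m' ∈ m :: L', B m') → ∃ m' ∈ L, B m' :=
          fun ⟨m', hm', hB⟩ => ⟨m', hsub hm', hB⟩
        by_cases hi : x (m ^^^ (m &&& P)).log2
        · refine hmem (ih _ _ _ h₁ (fun j hj => ?_) hA)
          rcases testBit_or_two_pow hj with hj | rfl
          exacts [hP j hj, hi]
        · have hAi : ∀ j, (A ||| 2 ^ (m ^^^ (m &&& P)).log2).testBit j = true → ¬ x j := by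
            intro j hj
            rcases testBit_or_two_pow hj with hj | rfl
            exacts [hA j hj, hi]
          rw [hx _ _ hAi] at h₂
          exact hmem (ih _ _ _ (by simpa using h₂) hP hAi)

/-- The tree in which every vertex other than `root` is joined to its image under `p`. -/
def parentGraph {W : Type*} (root : W) (p : W → W) : SimpleGraph W :=
  SimpleGraph.fromRel fun v w => v ≠ root ∧ p v = w

theorem parentGraph_isTree {W : Type*} [Finite W] (root : W) (p : W → W) (rank : W → ℕ)
    (hrank : ∀ v, v ≠ root → rank (p v) < rank v) : (parentGraph root p).IsTree := by
  classical
  have := Fintype.ofFinite W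
  have hadj : ∀ v, v ≠ root → (parentGraph root p).Adj v (p v) := fun v hv => by
    refine (SimpleGraph.fromRel_adj _ _ _).2 ⟨fun h => ?_, Or.inl ⟨hv, rfl⟩⟩
    have := hrank v hv
    rw [← h] at this
    exact this.false
  have hreach : ∀ k v, rank v = k → (parentGraph root p).Reachable v root := by
    intro k
    induction k using Nat.strong_induction_on with
    | _ k ih =>
      intro v hk
      by_cases hv : v = root
      · rw [hv]
      · exact (hadj v hv).reachable.trans (ih _ (hk ▸ hrank v hv) _ rfl)
  have hconn : (parentGraph root p).Connected :=
    { preconnected := fun v w => (hreach _ v rfl).trans (hreach _ w rfl).symm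
      nonempty := ⟨root⟩ }
  refine SimpleGraph.isTree_iff_connected_and_card.2 ⟨hconn, le_antisymm ?_ ?_⟩
  · have hsub : (parentGraph root p).edgeSet ⊆ (fun v => s(v, p v)) '' {v | v ≠ root} := by
      intro f
      induction f with
      | _ v w =>
        intro h
        rcases ((SimpleGraph.fromRel_adj _ _ _).1 ((SimpleGraph.mem_edgeSet _).1 h)).2 with
          ⟨hv, rfl⟩ | ⟨hw, rfl⟩
        exacts [⟨v, hv, rfl⟩, ⟨w, hw, Sym2.eq_swap⟩]
    have h₁ := (Set.ncard_le_ncard hsub (Set.toFinite _)).trans (Set.ncard_image_le (Set.toFinite _))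
    have h₂ : ({v | v ≠ root} : Set W).ncard + 1 = Nat.card W := by
      have := Set.ncard_add_ncard_compl ({root} : Set W)
      rw [Set.ncard_singleton] at this
      rw [← this, add_comm]
      rfl
    rw [Nat.card_coe_set_eq]
    omega
  · exact hconn.card_vert_le_card_edgeSet_add_one

theorem exists_hasSTTriple_of_parents [Fintype V] (G : SimpleGraph V) {s t : V} (hst : s ≠ t)
    (pos : V → ℕ) (hpos : pos.Injective) (up down : V → V)
    (hup : ∀ v, v ≠ t → pos v < pos (up v) ∧ G.Adj v (up v))
    (hdown : ∀ v, v ≠ s → pos (down v) < pos v ∧ G.Adj v (down v))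
    (hdisj : ∀ v, v ≠ t → down (up v) ≠ v) :
    ∃ H : SimpleGraph V, H ≤ G ∧ IsTwoT H ∧ HasSTTriple H s t := by
  have hle : ∀ (root : V) (p : V → V), (∀ v, v ≠ root → G.Adj v (p v)) →
      parentGraph root p ≤ G := by
    intro root p hp v w h
    rcases ((SimpleGraph.fromRel_adj _ _ _).1 h).2 with ⟨hv, rfl⟩ | ⟨hw, rfl⟩
    exacts [hp v hv, (hp w hw).symm]
  have hI : (parentGraph t up).IsTree :=
    parentGraph_isTree t up (fun v => Finset.univ.sup pos - pos v) fun v hv => by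
      have h₁ := (hup v hv).1
      have h₂ : pos (up v) ≤ Finset.univ.sup pos := Finset.le_sup (Finset.mem_univ _)
      change _ - _ < _ - _
      omega
  have hO : (parentGraph s down).IsTree :=
    parentGraph_isTree s down pos fun v hv => (hdown v hv).1
  have hbot : parentGraph t up ⊓ parentGraph s down = ⊥ := by
    have key : ∀ v w, v ≠ t → up v = w → ¬ (parentGraph s down).Adj v w := by
      rintro v w hv rfl h
      have h₁ := (hup v hv).1
      rcases ((SimpleGraph.fromRel_adj _ _ _).1 h).2 with ⟨hs, h⟩ | ⟨_, h⟩
      · have h₂ := (hdown v hs).1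
        rw [h] at h₂
        omega
      · exact hdisj v hv h
    ext v w
    simp only [SimpleGraph.inf_adj, SimpleGraph.bot_adj, iff_false, not_and]
    intro h
    rcases ((SimpleGraph.fromRel_adj _ _ _).1 h).2 with ⟨hv, h⟩ | ⟨hw, h⟩
    exacts [key v w hv h, fun h' => key w v hw h h'.symm]
  have hIH : IsSpanningTree (parentGraph t up ⊔ parentGraph s down) (parentGraph t up) :=
    ⟨le_sup_left, hI.1, hI.2⟩
  have hOH : IsSpanningTree (parentGraph t up ⊔ parentGraph s down) (parentGraph s down) :=
    ⟨le_sup_right, hO.1, hO.2⟩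
  have : Nontrivial V := ⟨s, t, hst⟩
  refine ⟨parentGraph t up ⊔ parentGraph s down,
    sup_le (hle t up fun v hv => (hup v hv).2) (hle s down fun v hv => (hdown v hv).2),
    ⟨Finite.one_lt_card, _, _, hIH, hOH, hbot, rfl⟩,
    LinearOrder.lift' pos hpos, _, _, hIH, hOH, hbot, fun v hv => ⟨up v, ?_, (hup v hv).1⟩,
    fun v hv => ⟨down v, ?_, (hdown v hv).1⟩⟩
  · exact (SimpleGraph.fromRel_adj _ _ _).2 ⟨(hup v hv).2.ne, Or.inl ⟨hv, rfl⟩⟩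
  · exact (SimpleGraph.fromRel_adj _ _ _).2 ⟨(hdown v hv).2.ne, Or.inl ⟨hv, rfl⟩⟩

/-- A scheme sends positions to later and to earlier positions, using no edge twice. -/
def SchemeValid (n : ℕ) (p : List ℕ × List ℕ) : Prop :=
  (∀ i < n - 1, i < p.1.getD i 0 ∧ p.1.getD i 0 < n ∧ p.2.getD (p.1.getD i 0) 0 ≠ i) ∧
    ∀ i < n, 0 < i → p.2.getD i 0 < i

instance (n : ℕ) (p : List ℕ × List ℕ) : Decidable (SchemeValid n p) := by
  unfold SchemeValid; infer_instance

theorem schemeValid_of_mem : ∀ n ∈ [4, 5, 6, 7], ∀ p ∈ schemes n, SchemeValid n p := by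
  decide

theorem exists_hasSTTriple_of_scheme [Fintype V] (G : SimpleGraph V) {n : ℕ} (hn : 2 ≤ n)
    (hcard : Fintype.card V = n) (b : ℕ → V) (hb : Set.InjOn b (Set.Iio n)) (p : List ℕ × List ℕ)
    (hp : SchemeValid n p) (hup : ∀ i < n - 1, G.Adj (b i) (b (p.1.getD i 0)))
    (hdown : ∀ i < n, 0 < i → G.Adj (b i) (b (p.2.getD i 0))) :
    ∃ H : SimpleGraph V, H ≤ G ∧ IsTwoT H ∧ HasSTTriple H (b 0) (b (n - 1)) := by
  have hbij : Function.Bijective fun i : Fin n => b i :=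
    (Fintype.bijective_iff_injective_and_card _).2
      ⟨fun i j h => Fin.ext (hb i.2 j.2 h), by simp [hcard]⟩
  have hsurj : ∀ v, ∃ i, i < n ∧ b i = v := fun v => by
    obtain ⟨i, hi⟩ := hbij.2 v
    exact ⟨i, i.2, hi⟩
  choose pos hpos_lt hpos using hsurj
  have hpos_b : ∀ i < n, pos (b i) = i := fun i hi => hb (hpos_lt _) hi (hpos _)
  have hlast : ∀ v, v ≠ b (n - 1) → pos v < n - 1 := fun v hv => by
    have h₁ := hpos_lt v
    have h₂ : pos v ≠ n - 1 := fun h => hv (by rw [← h, hpos])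
    omega
  have hfirst : ∀ v, v ≠ b 0 → 0 < pos v := fun v hv =>
    Nat.pos_of_ne_zero fun h => hv (by rw [← h, hpos])
  refine exists_hasSTTriple_of_parents G (fun h => ?_) pos
    (Function.LeftInverse.injective hpos) (fun v => b (p.1.getD (pos v) 0))
    (fun v => b (p.2.getD (pos v) 0)) (fun v hv => ?_) (fun v hv => ?_) fun v hv h => ?_
  · have := hb (show 0 < n by omega) (show n - 1 < n by omega) h
    omega
  · obtain ⟨h₁, h₂, -⟩ := hp.1 _ (hlast v hv)
    rw [hpos_b _ h₂]
    refine ⟨h₁, ?_⟩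
    simpa [hpos] using hup _ (hlast v hv)
  · have h₁ := hp.2 _ (hpos_lt v) (hfirst v hv)
    rw [hpos_b _ (h₁.trans (hpos_lt v))]
    refine ⟨h₁, ?_⟩
    simpa [hpos] using hdown _ (hpos_lt v) (hfirst v hv)
  · obtain ⟨h₁, h₂, h₃⟩ := hp.1 _ (hlast v hv)
    have h₄ := congrArg pos h
    simp only [hpos_b _ h₂] at h₄
    rw [hpos_b _ ((hp.2 _ h₂ (by omega)).trans h₂)] at h₄
    exact h₃ h₄

theorem adj_edgeCode_iff (G : SimpleGraph V) (a : ℕ → V) {n i j : ℕ} (hi : i < n) (hj : j < n) :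
    G.Adj (a (edgeCode n i j / n)) (a (edgeCode n i j % n)) ↔ G.Adj (a i) (a j) := by
  have hn : 0 < n := by omega
  rcases le_total i j with h | h
  · simp [edgeCode, h, Nat.mul_add_div hn, Nat.div_eq_of_lt hj, Nat.mod_eq_of_lt hj]
  · simp [edgeCode, h, Nat.mul_add_div hn, Nat.div_eq_of_lt hi, Nat.mod_eq_of_lt hi,
      G.adj_comm]

theorem card_nonneighbors_le [Fintype V] (G : SimpleGraph V) {k : ℕ} (v : V)
    (hdeg : k ≤ gdeg G v) (S : Finset V) (hS : ∀ w ∈ S, w ≠ v ∧ ¬ G.Adj v w) :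
    S.card ≤ Fintype.card V - 1 - k := by
  classical
  have h₁ : S ⊆ Gᶜ.neighborFinset v := fun w hw => by
    simpa [SimpleGraph.compl_adj, eq_comm] using hS w hw
  have h₂ := Finset.card_le_card h₁
  rw [SimpleGraph.card_neighborFinset_eq_degree, SimpleGraph.degree_compl] at h₂
  have h₃ : gdeg G v = G.degree v :=
    (congrArg Set.ncard (G.coe_neighborFinset v)).symm.trans (Set.ncard_coe_finset _)
  omega

theorem overfull_eq_false [Fintype V] (G : SimpleGraph V) {n k : ℕ} (hcard : Fintype.card V = n)
    (hdeg : ∀ v, k ≤ gdeg G v) (a : ℕ → V) (ha : Set.InjOn a (Set.Iio n)) (A i : ℕ)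
    (hA : ∀ j, A.testBit j = true → ¬ G.Adj (a (j / n)) (a (j % n))) :
    overfull n (n - 1 - k) A i = false := by
  classical
  subst hcard
  have key : ∀ v < Fintype.card V, maskDegree (Fintype.card V) A v ≤ Fintype.card V - 1 - k := by
    intro v hv
    rw [maskDegree, ← List.toFinset_card_of_nodup (List.nodup_range.filter _),
      ← Finset.card_image_of_injOn (f := a)]
    · refine card_nonneighbors_le G (a v) (hdeg _) _ fun w hw => ?_
      simp only [Finset.mem_image, List.mem_toFinset, List.mem_filter, List.mem_range,
        Bool.and_eq_true, bne_iff_ne] at hw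
      obtain ⟨w, ⟨hw, hwv, hbit⟩, rfl⟩ := hw
      exact ⟨fun h => hwv (ha hw hv h), fun h => hA _ hbit ((adj_edgeCode_iff G a hv hw).2 h)⟩
    · refine ha.mono fun w hw => ?_
      simp only [List.coe_toFinset, Set.mem_ofPred_eq, List.mem_filter, List.mem_range] at hw
      exact hw.1
  rw [← Bool.not_eq_true]
  simp only [overfull, Bool.or_eq_true, Bool.and_eq_true, Nat.blt_eq]
  rintro (⟨h, h'⟩ | ⟨h, h'⟩)
  exacts [(key _ h).not_gt h', (key _ h).not_gt h']

theorem exists_threshold (c : ℕ → ℕ) (N : ℕ) (hc : ∀ i j, 1 ≤ i → i ≤ j → j ≤ N → c i ≤ c j)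
    (τ : ℕ) : ∃ k ≤ N, ∀ i, 1 ≤ i → i ≤ N → (c i < τ ↔ i ≤ k) := by
  induction N with
  | zero => exact ⟨0, le_rfl, fun i _ _ => by omega⟩
  | succ N ih =>
    by_cases h : c (N + 1) < τ
    · exact ⟨N + 1, le_rfl, fun i hi hiN => ⟨fun _ => hiN, fun _ =>
        (hc i _ hi hiN le_rfl).trans_lt h⟩⟩
    · obtain ⟨k, hk, hk'⟩ := ih fun i j hi hij hj => hc i j hi hij (by omega)
      refine ⟨k, by omega, fun i hi hiN => ?_⟩
      rcases Nat.lt_or_ge N i with hlt | hle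
      · obtain rfl : i = N + 1 := by omega
        exact ⟨fun h' => absurd h' h, fun _ => by omega⟩
      · exact hk' i hi hle

/-- A labelling of the vertices from `s` to `t`, with the interior vertices sorted by adjacency
to `s` and then by adjacency to `t`. -/
theorem exists_sorted_labelling [Fintype V] (G : SimpleGraph V) {n : ℕ} (hn : 2 ≤ n)
    (hcard : Fintype.card V = n) {s t : V} (hst : s ≠ t) :
    ∃ (u : ℕ → V) (a b c : ℕ), Set.InjOn u (Set.Iio n) ∧ u 0 = s ∧ u (n - 1) = t ∧
      a ≤ b ∧ b ≤ c ∧ c ≤ n - 2 ∧ ∀ i, 1 ≤ i → i ≤ n - 2 →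
        (¬ G.Adj s (u i) ↔ i ≤ b) ∧ (¬ G.Adj t (u i) ↔ i ≤ a ∨ b < i ∧ i ≤ c) := by
  classical
  let key : V → ℕ := fun v => if v = s then 0 else if v = t then 5 else
    1 + ((if G.Adj s v then 2 else 0) + if G.Adj t v then 1 else 0)
  have hkey_zero : ∀ v, key v = 0 → v = s := fun v h => by
    by_contra hv
    simp only [key, hv, if_false] at h
    split_ifs at h; omega
  have hkey_five : ∀ v, 5 ≤ key v → v = t := fun v h => by
    by_contra hv
    simp only [key, hv, if_false] at h
    split_ifs at h <;> omega
  have hkey_s : key s = 0 := if_pos rfl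
  have hkey_t : key t = 5 := by simp [key, hst.symm]
  let e₀ : Fin n ≃ V := (Fintype.equivFinOfCardEq hcard).symm
  let e : Fin n ≃ V := (Tuple.sort (key ∘ e₀)).trans e₀
  have hmono : ∀ i j, i ≤ j → key (e i) ≤ key (e j) := fun i j h =>
    Tuple.monotone_sort (key ∘ e₀) h
  let u : ℕ → V := fun i => if h : i < n then e ⟨i, h⟩ else s
  have hu : ∀ i (h : i < n), u i = e ⟨i, h⟩ := fun i h => dif_pos h
  have hinj : Set.InjOn u (Set.Iio n) := fun i hi j hj h => by
    rw [hu i hi, hu j hj] at h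
    exact congrArg Fin.val (e.injective h)
  have hu_zero : u 0 = s := by
    refine hkey_zero _ (Nat.le_zero.1 ?_)
    have h := hmono ⟨0, by omega⟩ (e.symm s) (Nat.zero_le _)
    rwa [e.apply_symm_apply, hkey_s, ← hu] at h
  have hu_last : u (n - 1) = t := by
    refine hkey_five _ ?_
    have h := hmono (e.symm t) ⟨n - 1, by omega⟩ (Nat.le_sub_one_of_lt (e.symm t).2)
    rwa [e.apply_symm_apply, hkey_t, ← hu] at h
  obtain ⟨a, ha, ha'⟩ := exists_threshold (key ∘ u) (n - 2) (fun i j _ hij hj => by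
    simp only [Function.comp, hu i (by omega), hu j (by omega)]
    exact hmono _ _ hij) 2
  obtain ⟨b, hb, hb'⟩ := exists_threshold (key ∘ u) (n - 2) (fun i j _ hij hj => by
    simp only [Function.comp, hu i (by omega), hu j (by omega)]
    exact hmono _ _ hij) 3
  obtain ⟨c, hc, hc'⟩ := exists_threshold (key ∘ u) (n - 2) (fun i j _ hij hj => by
    simp only [Function.comp, hu i (by omega), hu j (by omega)]
    exact hmono _ _ hij) 4
  refine ⟨u, a, b, c, hinj, hu_zero, hu_last, ?_, ?_, hc, fun i hi hin => ?_⟩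
  · by_contra h
    have h₁ := ha' a (by omega) ha
    have h₂ := hb' a (by omega) ha
    omega
  · by_contra h
    have h₁ := hb' b (by omega) hb
    have h₂ := hc' b (by omega) hb
    omega
  · have hs : u i ≠ s := fun h => by
      have := hinj (show i < n by omega) (show 0 < n by omega) (h.trans hu_zero.symm)
      omega
    have ht : u i ≠ t := fun h => by
      have := hinj (show i < n by omega) (show n - 1 < n by omega) (h.trans hu_last.symm)
      omega
    rw [← not_le (b := b), ← ha' i hi hin, ← hb' i hi hin, ← hc' i hi hin]
    simp only [Function.comp, key, hs, ht, if_false]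
    split_ifs <;> simp [*]

theorem exists_hasSTTriple_of_coverCheck [Fintype V] (G : SimpleGraph V) {n : ℕ} (hn : 2 ≤ n)
    (hcard : Fintype.card V = n) (hcheck : coverCheck n = true)
    (hvalid : ∀ p ∈ schemes n, SchemeValid n p) (hdeg : ∀ v, n / 2 + 1 ≤ gdeg G v)
    {s t : V} (hst : s ≠ t) :
    ∃ H : SimpleGraph V, H ≤ G ∧ IsTwoT H ∧ HasSTTriple H s t := by
  obtain ⟨u, a, b, c, hu, rfl, rfl, hab, hbc, hcn, hends⟩ :=
    exists_sorted_labelling G hn hcard hst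
  have hx := overfull_eq_false G hcard hdeg u hu
  rw [show n - 1 - (n / 2 + 1) = n - 2 - n / 2 by omega] at hx
  have hA : ∀ j, (maskOf (missingEnds n a b c)).testBit j = true →
      ¬ G.Adj (u (j / n)) (u (j % n)) := by
    intro j hj
    simp only [testBit_maskOf, missingEnds, List.mem_append, List.mem_map, List.mem_filter,
      List.mem_range'_1, decide_eq_true_eq] at hj
    rcases hj with ⟨i, ⟨hi, h⟩, rfl⟩ | ⟨i, ⟨hi, h⟩, rfl⟩ <;>
      rw [adj_edgeCode_iff G u (by omega) (by omega)]
    exacts [(hends i hi.1 (by omega)).1.2 h, (hends i hi.1 (by omega)).2.2 h]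
  have hP : ∀ j, (maskOf (presentEnds n a b c)).testBit j = true →
      G.Adj (u (j / n)) (u (j % n)) := by
    intro j hj
    simp only [testBit_maskOf, presentEnds, List.mem_append, List.mem_map, List.mem_filter,
      List.mem_range'_1, decide_eq_true_eq] at hj
    rcases hj with ⟨i, ⟨hi, h⟩, rfl⟩ | ⟨i, ⟨hi, h⟩, rfl⟩ <;>
      rw [adj_edgeCode_iff G u (by omega) (by omega)]
    exacts [not_not.1 fun h' => h ((hends i hi.1 (by omega)).1.1 h'),
      not_not.1 fun h' => h ((hends i hi.1 (by omega)).2.1 h')]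
  simp only [coverCheck, List.all_eq_true, List.mem_range] at hcheck
  have hcov := hcheck c (by omega) b (by omega) a (by omega)
  have hnot : (missingEnds n a b c).any
      (overfull n (n - 2 - n / 2) (maskOf (missingEnds n a b c))) = false := by
    simp [List.any_eq_false, hx _ _ hA]
  rw [hnot, Bool.false_or] at hcov
  obtain ⟨m, hm, hmx⟩ := exists_of_covers hx _ _ _ _ hcov hP hA
  obtain ⟨⟨σ, p⟩, hσp, rfl⟩ := List.mem_map.1 hm
  obtain ⟨hσ, hp⟩ := List.mem_product.1 hσp
  obtain ⟨l, hl, rfl⟩ := List.mem_map.1 hσ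
  rw [List.mem_permutations'] at hl
  have hlen : l.length = n - 2 := by simpa using hl.length_eq
  set σ := 0 :: (l ++ [n - 1]) with hσdef
  have hσlen : σ.length = n := by simp [hσdef, hlen]; omega
  have hl_mem : ∀ i ∈ l, 1 ≤ i ∧ i < n - 1 := fun i hi => by
    have := List.mem_range'_1.1 (hl.mem_iff.1 hi)
    omega
  have hσnodup : σ.Nodup := by
    have h₁ : l.Nodup := hl.nodup_iff.2 List.nodup_range'
    have h₂ : 0 ∉ l := fun h => by have := hl_mem _ h; omega
    have h₃ : n - 1 ∉ l := fun h => by have := hl_mem _ h; omega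
    have h₄ : 0 ≠ n - 1 := by omega
    rw [hσdef, List.nodup_cons, List.nodup_append]
    refine ⟨by simp [h₂, h₄], h₁, List.nodup_singleton _, fun x hx y hy => ?_⟩
    rw [List.mem_singleton.1 hy]
    rintro rfl
    exact h₃ hx
  have hσ_mem : ∀ x ∈ σ, x < n := by
    intro x hx
    simp only [hσdef, List.mem_cons, List.mem_append, List.not_mem_nil, or_false] at hx
    rcases hx with h | h | h
    · omega
    · have := hl_mem _ h; omega
    · omega
  have hσ_lt : ∀ i, σ.getD i 0 < n := by
    intro i
    rcases lt_or_ge i σ.length with h | h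
    · rw [List.getD_eq_getElem _ _ h]
      exact hσ_mem _ (List.getElem_mem h)
    · rw [List.getD_eq_default _ _ h]; omega
  have hσ_last : σ.getD (n - 1) 0 = n - 1 := by
    rw [hσdef, show n - 1 = l.length + 1 by omega]
    simp
  have hadj : ∀ i j, edgeCode n (σ.getD i 0) (σ.getD j 0) ∈ schemeEdges n (σ, p) →
      G.Adj (u (σ.getD i 0)) (u (σ.getD j 0)) := fun i j h =>
    (adj_edgeCode_iff G u (hσ_lt i) (hσ_lt j)).1 (hmx _ ((testBit_maskOf _ _).2 h))
  have hres := exists_hasSTTriple_of_scheme G hn hcard (fun i => u (σ.getD i 0))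
    (fun i hi j hj h => ?_) p (hvalid p hp) (fun i hi => hadj _ _ ?_)
    (fun i hi hi' => hadj _ _ ?_)
  · rwa [hσ_last, show σ.getD 0 0 = 0 from rfl] at hres
  · have h' := hu (hσ_lt i) (hσ_lt j) h
    have hi' : i < σ.length := hσlen.symm ▸ hi
    have hj' : j < σ.length := hσlen.symm ▸ hj
    rw [List.getD_eq_getElem _ _ hi', List.getD_eq_getElem _ _ hj'] at h'
    exact (hσnodup.getElem_inj_iff).1 h'
  · exact List.mem_append_left _ (List.mem_map.2 ⟨i, List.mem_range.2 hi, rfl⟩)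
  · exact List.mem_append_right _
      (List.mem_map.2 ⟨i, List.mem_range'_1.2 ⟨hi', by omega⟩, rfl⟩)

/-- Every simple graph on `n ∈ {4,5,6,7}` vertices with minimum degree at least
`⌊n/2⌋ + 1` has property (*). -/
theorem stmt15 [Fintype V] (G : SimpleGraph V)
    (h4 : 4 ≤ Fintype.card V) (h7 : Fintype.card V ≤ 7)
    (hdeg : ∀ v : V, Fintype.card V / 2 + 1 ≤ gdeg G v) :
    PropertyStar G := by
  have hmem : Fintype.card V ∈ [4, 5, 6, 7] := by
    simp only [List.mem_cons, List.not_mem_nil, or_false]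
    omega
  exact fun s t hst => exists_hasSTTriple_of_coverCheck G (by omega) rfl
    (coverCheck_eq_true _ hmem) (schemeValid_of_mem _ hmem) hdeg hst
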